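/- There exists a polynomial poly_1 such that for every 1-VASS with disequality tests V=(Q,D,Δ,w) (with single disequality guards), every residue class R, and every n ∈ ℕ, |δ_n(R)| ≤ poly_1(|Q|). -/

import Mathlib

namespace VASSPaper

/-- A 1-VASS with disequality tests: states `Q`, transition relation `delta`,
integer weights `w`, and for each state a cofinite set `D q ⊆ ℕ` of allowed counter values. -/
structure OneVASS (Q : Type) where
  delta : Q → Q → Prop
  w : Q → Q → ℤ
  D : Q → Set ℕ
  cofinite : ∀ q, (D q)ᶜ.Finite

variable {Q : Type}

/-- A path is a nonempty sequence of states joined by transitions. -/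
def IsPath (V : OneVASS Q) : List Q → Prop
  | [] => False
  | [_] => True
  | a :: b :: l => V.delta a b ∧ IsPath V (b :: l)

/-- The weight of a path: the sum of the weights of its transitions. -/
def pathWeight (V : OneVASS Q) (π : List Q) : ℤ :=
  (List.zipWith V.w π π.tail).sum

/-- The counter value at position `i` of the run over `π` starting with counter `z`. -/
def counterAt (V : OneVASS Q) (z : ℕ) (π : List Q) (i : ℕ) : ℤ :=
  (z : ℤ) + pathWeight V (π.take (i + 1))

/-- `π` lifts to a run from counter value `z`: all counter values stay nonnegative. -/
def IsRun (V : OneVASS Q) (π : List Q) (z : ℕ) : Prop :=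
  IsPath V π ∧ ∀ i, i < π.length → 0 ≤ counterAt V z π i

/-- A valid run additionally respects all disequality guards. -/
def IsValidRun (V : OneVASS Q) (π : List Q) (z : ℕ) : Prop :=
  IsRun V π z ∧ ∀ i, ∀ h : i < π.length, (counterAt V z π i).toNat ∈ V.D (π.get ⟨i, h⟩)

/-- `π` goes from configuration `c` to configuration `c'`. -/
def RunFromTo (V : OneVASS Q) (π : List Q) (c c' : Q × ℕ) : Prop :=
  π.head? = some c.1 ∧ π.getLast? = some c'.1 ∧ (c'.2 : ℤ) = (c.2 : ℤ) + pathWeight V π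

/-- `c'` is reachable from `c` by a valid run. -/
def Reaches (V : OneVASS Q) (c c' : Q × ℕ) : Prop :=
  ∃ π, IsValidRun V π c.2 ∧ RunFromTo V π c c'

/-- A configuration is unbounded if infinitely many configurations are reachable from it. -/
def Unbounded (V : OneVASS Q) (c : Q × ℕ) : Prop :=
  {c' | Reaches V c c'}.Infinite

/-- `(s,0)` covers the state `t`. -/
def Covers (V : OneVASS Q) (s t : Q) : Prop :=
  ∃ z, Reaches V (s, 0) (t, z)

/-- Every state has at most one disequality guard. -/
def SingleGuard (V : OneVASS Q) : Prop :=
  ∀ q, V.D q = Set.univ ∨ ∃ g : ℕ, V.D q = {g}ᶜ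

/-- The minimum weight of a (possibly empty) prefix of `π`. -/
def pmin (V : OneVASS Q) (π : List Q) : ℤ :=
  ((List.range (π.length + 1)).map fun i => pathWeight V (π.take i)).foldr min 0

/-- The maximum weight of a (possibly empty) suffix of `π`. -/
def smax (V : OneVASS Q) (π : List Q) : ℤ :=
  ((List.range (π.length + 1)).map fun i => pathWeight V (π.drop i)).foldr max 0

/-- A cycle on `q`: a path with at least one transition starting and ending at `q`. -/
def IsCycleOn (V : OneVASS Q) (π : List Q) (q : Q) : Prop :=
  IsPath V π ∧ 2 ≤ π.length ∧ π.head? = some q ∧ π.getLast? = some q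

/-- A simple cycle on `q`. -/
def IsSimpleCycleOn (V : OneVASS Q) (π : List Q) (q : Q) : Prop :=
  IsCycleOn V π q ∧ π.dropLast.Nodup

/-- The set of states lying on a positive-weight simple cycle. -/
def Qplus (V : OneVASS Q) : Set Q :=
  {q | ∃ π, IsSimpleCycleOn V π q ∧ 0 < pathWeight V π}

/-- `γ` is a valid choice of cycles: for each `q ∈ Q₊`, `γ q` is a simple positive cycle
on `q` whose `pmin` is maximal among all positive-weight simple cycles on `q`. -/
def GammaChoice (V : OneVASS Q) (γ : Q → List Q) : Prop :=
  ∀ q ∈ Qplus V,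
    IsSimpleCycleOn V (γ q) q ∧ 0 < pathWeight V (γ q) ∧
      ∀ π, IsSimpleCycleOn V π q → 0 < pathWeight V π → pmin V π ≤ pmin V (γ q)

/-- `Conf₊`: configurations `(q,z)` with `q ∈ Q₊` and `z + pmin (γ q) ≥ 0`. -/
def ConfPlus (V : OneVASS Q) (γ : Q → List Q) : Set (Q × ℕ) :=
  {c | c.1 ∈ Qplus V ∧ 0 ≤ (c.2 : ℤ) + pmin V (γ c.1)}

/-- `W_q`, the weight of the chosen cycle `γ q`, as a natural number. -/
def Wnat (V : OneVASS Q) (γ : Q → List Q) (q : Q) : ℕ :=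
  (pathWeight V (γ q)).toNat

/-- The `q`-residue class of `r` modulo `W_q`. -/
def resClass (V : OneVASS Q) (γ : Q → List Q) (q : Q) (r : ℕ) : Set (Q × ℕ) :=
  {c | c ∈ ConfPlus V γ ∧ c.1 = q ∧ c.2 % Wnat V γ q = r}

/-- `iterCycle π k` is the cycle `π` iterated `k+1` times. -/
def iterCycle (π : List Q) : ℕ → List Q
  | 0 => π
  | k + 1 => iterCycle π k ++ π.tail

/-- Counter values `z < z'` at state `q` are connected by a valid run iterating `γ q`. -/
def chainLinked (V : OneVASS Q) (γ : Q → List Q) (q : Q) (z z' : ℕ) : Prop :=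
  ∃ k, IsValidRun V (iterCycle (γ q) k) z ∧
    (z' : ℤ) = (z : ℤ) + pathWeight V (iterCycle (γ q) k)

/-- Any two configurations of `S` are connected by iterating `γ q`. -/
def ChainCond (V : OneVASS Q) (γ : Q → List Q) (q : Q) (S : Set (Q × ℕ)) : Prop :=
  ∀ c ∈ S, ∀ c' ∈ S, c.2 < c'.2 → chainLinked V γ q c.2 c'.2

/-- A `q`-chain inside the `q`-residue class of `r`: a maximal subset whose
configurations are pairwise connected by iterating `γ q`. -/
def IsChainIn (V : OneVASS Q) (γ : Q → List Q) (q : Q) (r : ℕ) (C : Set (Q × ℕ)) : Prop :=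
  C ⊆ resClass V γ q r ∧ ChainCond V γ q C ∧
    ∀ C', C ⊆ C' → C' ⊆ resClass V γ q r → ChainCond V γ q C' → C' = C

/-- A chain (in some residue class of some state of `Q₊`). -/
def IsChain (V : OneVASS Q) (γ : Q → List Q) (C : Set (Q × ℕ)) : Prop :=
  ∃ q r, q ∈ Qplus V ∧ r < Wnat V γ q ∧ IsChainIn V γ q r C

/-- A set of configurations is bounded if its counter values are bounded. -/
def chainBounded (C : Set (Q × ℕ)) : Prop :=
  BddAbove (Prod.snd '' C)

/-- A residue class is trivial if it consists of a single unbounded chain. -/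
def TrivialClass (V : OneVASS Q) (γ : Q → List Q) (q : Q) (r : ℕ) : Prop :=
  IsChainIn V γ q r (resClass V γ q r) ∧ ¬ chainBounded (resClass V γ q r)

/-- There is a valid run of length `k` (i.e. `k` transitions) from `c` into the set `S`. -/
def RunLenTo (V : OneVASS Q) (c : Q × ℕ) (S : Set (Q × ℕ)) (k : ℕ) : Prop :=
  ∃ π c', c' ∈ S ∧ IsValidRun V π c.2 ∧ RunFromTo V π c c' ∧ π.length = k + 1

/-- Configurations of `Conf₊ \ Un` whose distance to `Un` is minimal among all
configurations of `Conf₊ \ Un`. -/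
def Uprime (V : OneVASS Q) (γ : Q → List Q) (Un : Set (Q × ℕ)) : Set (Q × ℕ) :=
  {c | c ∈ ConfPlus V γ \ Un ∧
    ∃ k, RunLenTo V c Un k ∧
      ∀ c' ∈ ConfPlus V γ \ Un, ∀ j, RunLenTo V c' Un j → k ≤ j}

/-- `S` is downward closed in every chain. -/
def dcClosed (V : OneVASS Q) (γ : Q → List Q) (S : Set (Q × ℕ)) : Prop :=
  ∀ C, IsChain V γ C → ∀ c ∈ S ∩ C, ∀ c' ∈ C, c'.2 ≤ c.2 → c' ∈ S

/-- The inductive sequence `U_n`: `U_0` is the union of the unbounded chains; `U_{n+1}` is the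
smallest superset of `U_n ∪ U'_n` that is downward closed in every chain. -/
def U (V : OneVASS Q) (γ : Q → List Q) : ℕ → Set (Q × ℕ)
  | 0 => ⋃₀ {C | IsChain V γ C ∧ ¬ chainBounded C}
  | n + 1 => ⋂₀ {S | U V γ n ∪ Uprime V γ (U V γ n) ⊆ S ∧ dcClosed V γ S}

/-- `C` is an `n`-active bounded chain in the `q`-residue class of `r`. -/
def nActiveIn (V : OneVASS Q) (γ : Q → List Q) (q : Q) (r : ℕ) (n : ℕ)
    (C : Set (Q × ℕ)) : Prop :=
  IsChainIn V γ q r C ∧ chainBounded C ∧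
    ∃ c ∈ U V γ n ∩ resClass V γ q r, ∃ c' ∈ C, c.2 ≤ c'.2

/-- `δ_n(C)` for a `q`-chain `C`: configurations outside `U_n` whose counter value lies
between two counter values of `C \ U_n`. -/
def deltaC (V : OneVASS Q) (γ : Q → List Q) (n : ℕ) (q : Q) (C : Set (Q × ℕ)) :
    Set (Q × ℕ) :=
  {c | c ∈ ConfPlus V γ ∧ c.1 = q ∧ c ∉ U V γ n ∧
    ∃ z₁ z₂, (q, z₁) ∈ C \ U V γ n ∧ (q, z₂) ∈ C \ U V γ n ∧ z₁ ≤ c.2 ∧ c.2 ≤ z₂}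

/-- `δ_n(R)` for the `q`-residue class `R` of `r`: union of `δ_n(C)` over `n`-active chains. -/
def deltaR (V : OneVASS Q) (γ : Q → List Q) (n : ℕ) (q : Q) (r : ℕ) : Set (Q × ℕ) :=
  {c | ∃ C, nActiveIn V γ q r n C ∧ c ∈ deltaC V γ n q C}

/-- A positive-weight cycle (as a list of states). -/
def IsPosCycle (V : OneVASS Q) (π : List Q) : Prop :=
  2 ≤ π.length ∧ π.head? = π.getLast? ∧ 0 < pathWeight V π

/-- A path is primitive if no proper infix of it is a positive-weight cycle. -/
def Primitive (V : OneVASS Q) (π : List Q) : Prop :=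
  ∀ i l, (π.drop i).take l ≠ π → ¬ IsPosCycle V ((π.drop i).take l)

/-! ### Paths, runs and lists of configurations -/

theorem pathWeight_singleton (V : OneVASS Q) (a : Q) : pathWeight V [a] = 0 := by
  simp [pathWeight]

theorem pathWeight_cons_cons (V : OneVASS Q) (a b : Q) (l : List Q) :
    pathWeight V (a :: b :: l) = V.w a b + pathWeight V (b :: l) := by
  simp [pathWeight]

theorem pathWeight_append_cons (V : OneVASS Q) (A : List Q) (x : Q) (B : List Q) :
    pathWeight V (A ++ x :: B) = pathWeight V (A ++ [x]) + pathWeight V (x :: B) := by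
  induction A with
  | nil => simp [pathWeight_singleton]
  | cons a A ih =>
    cases A with
    | nil => simp [pathWeight_cons_cons, pathWeight_singleton]
    | cons b A =>
      simp only [List.cons_append, pathWeight_cons_cons] at ih ⊢
      rw [ih]; ring

theorem isRun_singleton (V : OneVASS Q) (a : Q) (z : ℕ) : IsRun V [a] z := by
  refine ⟨trivial, fun i hi => ?_⟩
  simp [counterAt, pathWeight_singleton]

theorem counterAt_zero (V : OneVASS Q) (z : ℕ) (a : Q) (l : List Q) :
    counterAt V z (a :: l) 0 = z := by
  simp [counterAt, pathWeight_singleton]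

theorem counterAt_succ (V : OneVASS Q) (z z' : ℕ) (a b : Q) (l : List Q)
    (h : (z' : ℤ) = z + V.w a b) (i : ℕ) :
    counterAt V z (a :: b :: l) (i + 1) = counterAt V z' (b :: l) i := by
  simp only [counterAt, List.take_succ_cons, pathWeight_cons_cons, h]
  ring

theorem isRun_cons_cons (V : OneVASS Q) (a b : Q) (l : List Q) (z : ℕ) :
    IsRun V (a :: b :: l) z ↔
      V.delta a b ∧ ∃ z' : ℕ, (z' : ℤ) = z + V.w a b ∧ IsRun V (b :: l) z' := by
  constructor
  · rintro ⟨⟨h1, h2⟩, h3⟩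
    refine ⟨h1, ?_⟩
    have h4 := h3 1 (by simp)
    simp only [counterAt, List.take_succ_cons, pathWeight_cons_cons, List.take_zero,
      pathWeight_singleton, add_zero] at h4
    have h5 : (((z : ℤ) + V.w a b).toNat : ℤ) = z + V.w a b := Int.toNat_of_nonneg h4
    refine ⟨_, h5, h2, fun i hi => ?_⟩
    rw [← counterAt_succ V z _ a b l h5]
    exact h3 (i + 1) (by simpa using hi)
  · rintro ⟨h1, z', hz, h2, h3⟩
    refine ⟨⟨h1, h2⟩, fun i hi => ?_⟩
    cases i with
    | zero => rw [counterAt_zero]; positivity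
    | succ i =>
      rw [counterAt_succ V z z' a b l hz]
      exact h3 i (by simpa using hi)

theorem isValidRun_singleton (V : OneVASS Q) (a : Q) (z : ℕ) :
    IsValidRun V [a] z ↔ z ∈ V.D a := by
  constructor
  · rintro ⟨_, h⟩
    simpa [counterAt_zero] using h 0 (by simp)
  · intro h
    refine ⟨isRun_singleton V a z, fun i hi => ?_⟩
    obtain rfl : i = 0 := by simpa using hi
    simpa [counterAt_zero] using h

theorem isValidRun_cons_cons (V : OneVASS Q) (a b : Q) (l : List Q) (z : ℕ) :
    IsValidRun V (a :: b :: l) z ↔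
      z ∈ V.D a ∧ V.delta a b ∧
        ∃ z' : ℕ, (z' : ℤ) = z + V.w a b ∧ IsValidRun V (b :: l) z' := by
  constructor
  · rintro ⟨h1, h2⟩
    obtain ⟨h3, z', hz, h4⟩ := (isRun_cons_cons V a b l z).1 h1
    refine ⟨by simpa [counterAt_zero] using h2 0 (by simp), h3, z', hz, h4, fun i hi => ?_⟩
    have := h2 (i + 1) (by simpa using hi)
    rwa [counterAt_succ V z z' a b l hz] at this
  · rintro ⟨h1, h3, z', hz, h4, h5⟩
    refine ⟨(isRun_cons_cons V a b l z).2 ⟨h3, z', hz, h4⟩, fun i hi => ?_⟩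
    cases i with
    | zero => simpa [counterAt_zero] using h1
    | succ i =>
      rw [counterAt_succ V z z' a b l hz]
      exact h5 i (by simpa using hi)

/-- One transition between configurations. -/
def ConfStep (V : OneVASS Q) (c c' : Q × ℕ) : Prop :=
  V.delta c.1 c'.1 ∧ (c'.2 : ℤ) = c.2 + V.w c.1 c'.1

/-- One transition after which the counter may be lowered. -/
def LossyStep (V : OneVASS Q) (c c' : Q × ℕ) : Prop :=
  V.delta c.1 c'.1 ∧ (c'.2 : ℤ) ≤ c.2 + V.w c.1 c'.1

theorem ConfStep.lossy {V : OneVASS Q} {c c' : Q × ℕ} (h : ConfStep V c c') :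
    LossyStep V c c' := ⟨h.1, h.2.le⟩

theorem exists_configs_of_isValidRun (V : OneVASS Q) (a : Q) (l : List Q) (z : ℕ)
    (h : IsValidRun V (a :: l) z) :
    ∃ L : List (Q × ℕ), L.map Prod.fst = l ∧ List.IsChain (ConfStep V) ((a, z) :: L) ∧
      (∀ c ∈ (a, z) :: L, c.2 ∈ V.D c.1) ∧
      ∃ d, ((a, z) :: L).getLast? = some d ∧ (a :: l).getLast? = some d.1 ∧
        (d.2 : ℤ) = z + pathWeight V (a :: l) := by
  induction l generalizing a z with
  | nil =>
    refine ⟨[], rfl, by simp, ?_, (a, z), by simp, by simp, by simp [pathWeight_singleton]⟩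
    simpa [isValidRun_singleton] using h
  | cons b l ih =>
    obtain ⟨h1, h2, z', hz, h3⟩ := (isValidRun_cons_cons V a b l z).1 h
    obtain ⟨L, hL, hc, hv, d, hd, hd1, hd2⟩ := ih b z' h3
    refine ⟨(b, z') :: L, by simp [hL], ?_, ?_, d, ?_, ?_, ?_⟩
    · rw [List.isChain_cons_cons]; exact ⟨⟨h2, hz⟩, hc⟩
    · intro c hc'
      rcases List.mem_cons.1 hc' with rfl | hc'
      · exact h1
      · exact hv c hc'
    · rwa [List.getLast?_cons_cons]
    · rwa [List.getLast?_cons_cons]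
    · rw [pathWeight_cons_cons, hd2, hz]; ring

theorem isValidRun_of_configs (V : OneVASS Q) (a : Q) (z : ℕ) (L : List (Q × ℕ))
    (hc : List.IsChain (ConfStep V) ((a, z) :: L))
    (hv : ∀ c ∈ (a, z) :: L, c.2 ∈ V.D c.1) (d : Q × ℕ)
    (hd : ((a, z) :: L).getLast? = some d) :
    IsValidRun V (a :: L.map Prod.fst) z ∧ (a :: L.map Prod.fst).getLast? = some d.1 ∧
      (d.2 : ℤ) = z + pathWeight V (a :: L.map Prod.fst) := by
  induction L generalizing a z with
  | nil =>
    obtain rfl : (a, z) = d := by simpa using hd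
    simpa [isValidRun_singleton, pathWeight_singleton] using hv
  | cons b L ih =>
    obtain ⟨b, z'⟩ := b
    rw [List.isChain_cons_cons] at hc
    rw [List.getLast?_cons_cons] at hd
    obtain ⟨h1, h2, h3⟩ := ih b z' hc.2 (fun c hc' => hv c (List.mem_cons_of_mem _ hc')) hd
    simp only [List.map_cons]
    refine ⟨(isValidRun_cons_cons V _ _ _ _).2
      ⟨hv (a, z) (by simp), hc.1.1, z', hc.1.2, h1⟩, ?_, ?_⟩
    · rwa [List.getLast?_cons_cons]
    · have := hc.1.2
      simp only at this
      rw [pathWeight_cons_cons, h3, this]; ring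

theorem runLenTo_iff (V : OneVASS Q) (c : Q × ℕ) (S : Set (Q × ℕ)) (k : ℕ) :
    RunLenTo V c S k ↔ ∃ L : List (Q × ℕ), L.length = k ∧
      List.IsChain (ConfStep V) (c :: L) ∧ (∀ d ∈ c :: L, d.2 ∈ V.D d.1) ∧
      ∃ d ∈ S, (c :: L).getLast? = some d := by
  obtain ⟨a, z⟩ := c
  constructor
  · rintro ⟨π, c', hS, hv, ⟨hh, hl, hw⟩, hlen⟩
    obtain ⟨b, l, rfl⟩ : ∃ b l, π = b :: l := List.exists_cons_of_length_eq_add_one hlen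
    obtain rfl : b = a := by simpa using hh
    obtain ⟨L, hL, hc, hv', d, hd, hd1, hd2⟩ := exists_configs_of_isValidRun V b l z hv
    have hdc : d = c' := by
      rw [hl] at hd1
      simp only [Option.some.injEq] at hd1
      ext
      · exact hd1.symm
      · have : (d.2 : ℤ) = c'.2 := by rw [hd2, hw]
        exact_mod_cast this
    refine ⟨L, ?_, hc, hv', d, hdc ▸ hS, hd⟩
    have : l.length = k := by simpa using hlen
    rw [← this, ← hL, List.length_map]
  · rintro ⟨L, hlen, hc, hv, d, hS, hd⟩
    obtain ⟨h1, h2, h3⟩ := isValidRun_of_configs V a z L hc hv d hd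
    exact ⟨_, d, hS, h1, ⟨rfl, h2, h3⟩, by simp [hlen]⟩

/-- A chain of lossy steps can be executed as a run from every larger counter value. -/
theorem isRun_of_lossy (V : OneVASS Q) (a : Q) (z : ℕ) (L : List (Q × ℕ))
    (hc : List.IsChain (LossyStep V) ((a, z) :: L)) (d : Q × ℕ)
    (hd : ((a, z) :: L).getLast? = some d) (x : ℕ) (hx : z ≤ x) :
    IsRun V (a :: L.map Prod.fst) x ∧
      (d.2 : ℤ) ≤ z + pathWeight V (a :: L.map Prod.fst) := by
  induction L generalizing a z x with
  | nil =>
    obtain rfl : (a, z) = d := by simpa using hd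
    simp [isRun_singleton, pathWeight_singleton]
  | cons b L ih =>
    obtain ⟨b, z'⟩ := b
    rw [List.isChain_cons_cons] at hc
    rw [List.getLast?_cons_cons] at hd
    have h1 := hc.1.2
    simp only at h1
    obtain ⟨x', hx'⟩ : ∃ x' : ℕ, (x' : ℤ) = x + V.w a b :=
      ⟨((x : ℤ) + V.w a b).toNat, Int.toNat_of_nonneg (by omega)⟩
    obtain ⟨h2, h3⟩ := ih b z' hc.2 hd x' (by omega)
    simp only [List.map_cons]
    refine ⟨(isRun_cons_cons V _ _ _ _).2 ⟨hc.1.1, x', hx', h2⟩, ?_⟩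
    rw [pathWeight_cons_cons]; omega

theorem SingleGuard.exists_guard {V : OneVASS Q} (h : SingleGuard V) (q : Q) :
    ∃ g : ℕ, ∀ x, x ≠ g → x ∈ V.D q := by
  rcases h q with h | ⟨g, h⟩
  · exact ⟨0, fun x _ => h ▸ Set.mem_univ x⟩
  · exact ⟨g, fun x hx => h ▸ hx⟩

/-- A path is blocked by guards from at most as many counter values as it has states. -/
theorem exists_blocked_finset {V : OneVASS Q} (h : SingleGuard V) (π : List Q) :
    ∃ F : Finset ℕ, F.card ≤ π.length ∧ ∀ x, IsRun V π x → x ∉ F → IsValidRun V π x := by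
  classical
  induction π with
  | nil => exact ⟨∅, by simp, fun x hx => hx.1.elim⟩
  | cons a l ih =>
    obtain ⟨g, hg⟩ := h.exists_guard a
    cases l with
    | nil =>
      refine ⟨{g}, by simp, fun x _ hx => ?_⟩
      rw [isValidRun_singleton]
      exact hg x (by simpa using hx)
    | cons b l =>
      obtain ⟨F, hF, hF'⟩ := ih
      refine ⟨insert g (F.image fun v : ℕ => ((v : ℤ) - V.w a b).toNat), ?_, fun x hx hxF => ?_⟩
      · refine (Finset.card_insert_le _ _).trans ?_
        have := (Finset.card_image_le (s := F) (f := fun v : ℕ => ((v : ℤ) - V.w a b).toNat))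
        simp only [List.length_cons] at hF ⊢
        omega
      · obtain ⟨h1, z', hz, h2⟩ := (isRun_cons_cons V a b l x).1 hx
        simp only [Finset.mem_insert, Finset.mem_image, not_or, not_exists, not_and] at hxF
        refine (isValidRun_cons_cons V a b l x).2 ⟨hg x hxF.1, h1, z', hz, hF' z' h2 ?_⟩
        intro hzF
        exact hxF.2 z' hzF (by omega)

theorem isRun_iff_pmin {V : OneVASS Q} {π : List Q} (hπ : IsPath V π) (z : ℕ) :
    IsRun V π z ↔ 0 ≤ (z : ℤ) + pmin V π := by
  have key : ∀ (l : List ℤ) (c : ℤ), c ≤ l.foldr min 0 ↔ c ≤ 0 ∧ ∀ x ∈ l, c ≤ x := by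
    intro l c
    induction l with
    | nil => simp
    | cons a l ih => simp [ih]; tauto
  have h2 : 0 ≤ (z : ℤ) + pmin V π ↔ -(z : ℤ) ≤ pmin V π := by omega
  rw [h2, pmin, key]
  simp only [List.mem_map, List.mem_range, forall_exists_index, and_imp,
    forall_apply_eq_imp_iff₂]
  constructor
  · rintro ⟨_, h⟩
    refine ⟨by omega, fun i hi => ?_⟩
    cases i with
    | zero => simp [pathWeight]
    | succ i =>
      have := h i (by omega)
      unfold counterAt at this
      omega
  · rintro ⟨_, h⟩
    refine ⟨hπ, fun i hi => ?_⟩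
    have := h (i + 1) (by omega)
    unfold counterAt
    omega

/-! ### Chains and the sets `U n` -/

theorem isValidRun_append_cons (V : OneVASS Q) (A : List Q) (x : Q) (B : List Q) (z : ℕ) :
    IsValidRun V (A ++ x :: B) z ↔ IsValidRun V (A ++ [x]) z ∧
      ∃ z' : ℕ, (z' : ℤ) = z + pathWeight V (A ++ [x]) ∧ IsValidRun V (x :: B) z' := by
  have hD : ∀ (x : Q) (B : List Q) (z : ℕ), IsValidRun V (x :: B) z → z ∈ V.D x := by
    intro x B z h
    cases B with
    | nil => exact (isValidRun_singleton V x z).1 h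
    | cons b B => exact ((isValidRun_cons_cons V x b B z).1 h).1
  induction A generalizing z with
  | nil =>
    simp only [List.nil_append, pathWeight_singleton, add_zero, isValidRun_singleton]
    constructor
    · exact fun h => ⟨hD x B z h, z, rfl, h⟩
    · rintro ⟨_, z', hz, h⟩
      obtain rfl : z' = z := by exact_mod_cast hz
      exact h
  | cons a A ih =>
    have step : ∀ (b : Q) (l l' : List Q),
        (∀ z, IsValidRun V (b :: l) z ↔ IsValidRun V (b :: l') z ∧ ∃ z' : ℕ,
          (z' : ℤ) = z + pathWeight V (b :: l') ∧ IsValidRun V (x :: B) z') →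
        (IsValidRun V (a :: b :: l) z ↔ IsValidRun V (a :: b :: l') z ∧ ∃ z' : ℕ,
          (z' : ℤ) = z + pathWeight V (a :: b :: l') ∧ IsValidRun V (x :: B) z') := by
      intro b l l' h
      rw [isValidRun_cons_cons, isValidRun_cons_cons, pathWeight_cons_cons]
      constructor
      · rintro ⟨h1, h2, z1, hz1, h3⟩
        obtain ⟨h4, z2, hz2, h5⟩ := (h z1).1 h3
        exact ⟨⟨h1, h2, z1, hz1, h4⟩, z2, by omega, h5⟩
      · rintro ⟨⟨h1, h2, z1, hz1, h4⟩, z2, hz2, h5⟩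
        exact ⟨h1, h2, z1, hz1, (h z1).2 ⟨h4, z2, by omega, h5⟩⟩
    cases A with
    | nil => exact step x B [] (by simpa using ih)
    | cons b A => exact step b (A ++ x :: B) (A ++ [x]) (by simpa using ih)

theorem iterCycle_spec (V : OneVASS Q) (q : Q) (t : List Q) (W : ℕ)
    (hl : (q :: t).getLast? = some q) (hW : pathWeight V (q :: t) = W) (k : ℕ) :
    (iterCycle (q :: t) k).getLast? = some q ∧
      pathWeight V (iterCycle (q :: t) k) = ((k + 1) * W : ℕ) ∧
      ∀ z, IsValidRun V (iterCycle (q :: t) k) z ↔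
        ∀ j ≤ k, IsValidRun V (q :: t) (z + j * W) := by
  induction k with
  | zero => exact ⟨hl, by simp [iterCycle, hW], fun z => by simp [iterCycle]⟩
  | succ k ih =>
    obtain ⟨h1, h2, h3⟩ := ih
    obtain ⟨A, hA⟩ := List.getLast?_eq_some_iff.1 h1
    have hs : iterCycle (q :: t) (k + 1) = A ++ q :: t := by
      simp [iterCycle, hA]
    rw [hA] at h2 h3
    rw [hs]
    refine ⟨?_, ?_, fun z => ?_⟩
    · rw [List.getLast?_append, hl]; rfl
    · rw [pathWeight_append_cons, h2, hW]; push_cast; ring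
    · rw [isValidRun_append_cons, h3, h2]
      constructor
      · rintro ⟨h4, z', hz', h5⟩ j hj
        rcases Nat.lt_or_ge k j with hkj | hkj
        · obtain rfl : j = k + 1 := by omega
          obtain rfl : z' = z + (k + 1) * W := by exact_mod_cast hz'
          exact h5
        · exact h4 j hkj
      · intro h
        exact ⟨fun j hj => h j (by omega), z + (k + 1) * W, by push_cast; ring,
          h (k + 1) le_rfl⟩

/-- Iterating `γ q` leads from counter value `z` to `z'`. -/
def Linked (V : OneVASS Q) (γ : Q → List Q) (q : Q) (z z' : ℕ) : Prop :=
  z ≤ z' ∧ z % Wnat V γ q = z' % Wnat V γ q ∧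
    ∀ u, z ≤ u → u < z' → u % Wnat V γ q = z % Wnat V γ q → IsValidRun V (γ q) u

section GammaChoice

variable {V : OneVASS Q} {γ : Q → List Q}

theorem GammaChoice.pathWeight_eq (hγ : GammaChoice V γ) {q : Q} (hq : q ∈ Qplus V) :
    pathWeight V (γ q) = Wnat V γ q :=
  (Int.toNat_of_nonneg (hγ q hq).2.1.le).symm

theorem GammaChoice.Wnat_pos (hγ : GammaChoice V γ) {q : Q} (hq : q ∈ Qplus V) :
    0 < Wnat V γ q := by
  have := (hγ q hq).2.1
  rw [hγ.pathWeight_eq hq] at this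
  exact_mod_cast this

theorem GammaChoice.chainLinked_iff (hγ : GammaChoice V γ) {q : Q} (hq : q ∈ Qplus V)
    {z z' : ℕ} (hz : z < z') : chainLinked V γ q z z' ↔ Linked V γ q z z' := by
  obtain ⟨⟨_, _, hh, hl⟩, _⟩ := (hγ q hq).1
  have hW := hγ.pathWeight_eq hq
  have hWpos := hγ.Wnat_pos hq
  unfold chainLinked Linked
  obtain ⟨t, ht⟩ : ∃ t, γ q = q :: t := List.head?_eq_some_iff.1 hh
  generalize Wnat V γ q = W at hW hWpos ⊢
  rw [ht] at hl hW ⊢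
  have spec := iterCycle_spec V q t W hl hW
  constructor
  · rintro ⟨k, hv, hw⟩
    rw [(spec k).2.1] at hw
    rw [(spec k).2.2] at hv
    obtain rfl : z' = z + (k + 1) * W := by exact_mod_cast hw
    refine ⟨hz.le, by simp, fun u hu hu' hr => ?_⟩
    obtain ⟨j, hj⟩ := (Nat.modEq_iff_dvd' hu).1 hr.symm
    obtain rfl : u = z + j * W := by rw [mul_comm]; omega
    refine hv j ?_
    have : j * W < (k + 1) * W := by omega
    have := Nat.lt_of_mul_lt_mul_right this
    omega
  · rintro ⟨_, hr, hv⟩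
    obtain ⟨j, hj⟩ := (Nat.modEq_iff_dvd' hz.le).1 hr
    cases j with
    | zero => omega
    | succ k =>
      have hz' : z' = z + (k + 1) * W := by rw [mul_comm]; omega
      refine ⟨k, ?_, ?_⟩
      · rw [(spec k).2.2]
        intro j hj
        refine hv _ (by omega) ?_ (by simp)
        have : j * W < (k + 1) * W := Nat.mul_lt_mul_of_pos_right (by omega) hWpos
        omega
      · rw [(spec k).2.1, hz']; push_cast; ring

theorem Linked.refl (q : Q) (z : ℕ) : Linked V γ q z z :=
  ⟨le_rfl, rfl, fun _ _ _ => by omega⟩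

theorem Linked.trans {q : Q} {x y z : ℕ} (h : Linked V γ q x y) (h' : Linked V γ q y z) :
    Linked V γ q x z := by
  refine ⟨h.1.trans h'.1, h.2.1.trans h'.2.1, fun u h1 h2 h3 => ?_⟩
  rcases Nat.lt_or_ge u y with hu | hu
  · exact h.2.2 u h1 hu h3
  · exact h'.2.2 u hu h2 (h3.trans h.2.1)

theorem Linked.of_le_left {q : Q} {x y z : ℕ} (h : Linked V γ q x z) (hxy : x ≤ y)
    (hyz : y ≤ z) (hr : x % Wnat V γ q = y % Wnat V γ q) :
    Linked V γ q x y ∧ Linked V γ q y z :=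
  ⟨⟨hxy, hr, fun u h1 h2 h3 => h.2.2 u h1 (by omega) h3⟩,
    hyz, hr.symm.trans h.2.1, fun u h1 h2 h3 => h.2.2 u (by omega) h2 (h3.trans hr.symm)⟩

theorem mem_ConfPlus_of_le {q : Q} {x y : ℕ} (h : (q, x) ∈ ConfPlus V γ) (hxy : x ≤ y) :
    (q, y) ∈ ConfPlus V γ := by
  refine ⟨h.1, h.2.trans ?_⟩
  simpa using hxy

theorem IsChain.linked (hγ : GammaChoice V γ) {q : Q} {r : ℕ} {C : Set (Q × ℕ)}
    (hC : IsChainIn V γ q r C) (hq : q ∈ Qplus V) {c c' : Q × ℕ} (hc : c ∈ C) (hc' : c' ∈ C)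
    (h : c.2 ≤ c'.2) : Linked V γ q c.2 c'.2 := by
  rcases h.eq_or_lt with h | h
  · rw [h]; exact Linked.refl _ _
  · exact (hγ.chainLinked_iff hq h).1 (hC.2.1 c hc c' hc' h)

/-- The configurations linked with a given one form a chain. -/
theorem isChainIn_linked (hγ : GammaChoice V γ) {q : Q} {x : ℕ}
    (hx : (q, x) ∈ ConfPlus V γ) :
    IsChainIn V γ q (x % Wnat V γ q) {c | c ∈ resClass V γ q (x % Wnat V γ q) ∧
      (Linked V γ q c.2 x ∨ Linked V γ q x c.2)} := by
  have hq : q ∈ Qplus V := hx.1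
  refine ⟨fun c hc => hc.1, ?_, ?_⟩
  · rintro c ⟨hc, h⟩ c' ⟨hc', h'⟩ hlt
    rw [hγ.chainLinked_iff hq hlt]
    rcases h with h | h <;> rcases h' with h' | h'
    · exact (h.of_le_left hlt.le h'.1 (hc.2.2.trans hc'.2.2.symm)).1
    · exact h.trans h'
    · have := h.1; have := h'.1; omega
    · exact (h'.of_le_left h.1 hlt.le hc.2.2.symm).2
  · intro C' hsub hC' hcond
    refine Set.Subset.antisymm (fun c hc => ⟨hC' hc, ?_⟩) hsub
    have hxC : (q, x) ∈ C' := hsub ⟨⟨hx, rfl, rfl⟩, Or.inl (Linked.refl _ _)⟩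
    rcases lt_trichotomy c.2 x with h | h | h
    · exact Or.inl ((hγ.chainLinked_iff hq h).1 (hcond c hc _ hxC h))
    · rw [h]; exact Or.inl (Linked.refl _ _)
    · exact Or.inr ((hγ.chainLinked_iff hq h).1 (hcond _ hxC c hc h))

theorem mem_U_zero_iff (hγ : GammaChoice V γ) {q : Q} {x : ℕ} :
    (q, x) ∈ U V γ 0 ↔ (q, x) ∈ ConfPlus V γ ∧
      ∀ u, x ≤ u → u % Wnat V γ q = x % Wnat V γ q → IsValidRun V (γ q) u := by
  constructor
  · rintro ⟨C, ⟨⟨q', r, hq, hr, hC⟩, hunb⟩, hxC⟩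
    obtain ⟨hconf, rfl, hres⟩ := hC.1 hxC
    refine ⟨hconf, fun u hu hur => ?_⟩
    obtain ⟨_, ⟨c, hc, rfl⟩, hlt⟩ := (not_bddAbove_iff.1 hunb) u
    exact (IsChain.linked hγ hC hq hxC hc (by simp only; omega)).2.2 u hu hlt hur
  · rintro ⟨hx, h⟩
    have hW := hγ.Wnat_pos hx.1
    refine ⟨_, ⟨⟨q, _, hx.1, Nat.mod_lt _ hW, isChainIn_linked hγ hx⟩, ?_⟩,
      ⟨hx, rfl, rfl⟩, Or.inl (Linked.refl _ _)⟩
    refine not_bddAbove_iff.2 fun u => ⟨x + (u + 1) * Wnat V γ q, ⟨(q, _), ⟨⟨?_, rfl, ?_⟩,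
      Or.inr ⟨?_, ?_, fun v h1 _ h2 => h v h1 h2⟩⟩, rfl⟩, ?_⟩
    · exact mem_ConfPlus_of_le hx (by omega)
    · simp
    · simp
    · simp
    · have : (u + 1) * 1 ≤ (u + 1) * Wnat V γ q := Nat.mul_le_mul_left _ hW
      omega

/-- Closure under chain predecessors, phrased through `Linked`. -/
theorem dcClosed_of_linked (hγ : GammaChoice V γ) {S : Set (Q × ℕ)}
    (h : ∀ q x y, (q, x) ∈ ConfPlus V γ → Linked V γ q x y → (q, y) ∈ S → (q, x) ∈ S) :
    dcClosed V γ S := by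
  rintro C ⟨q, r, hq, hr, hC⟩ ⟨q1, y⟩ ⟨hS, hc⟩ ⟨q2, x⟩ hc' hle
  obtain ⟨_, rfl, _⟩ := hC.1 hc
  obtain ⟨hx, rfl, _⟩ := hC.1 hc'
  exact h _ x y hx (IsChain.linked hγ hC hq hc' hc hle) hS

theorem dcClosed.mem_of_linked (hγ : GammaChoice V γ) {S : Set (Q × ℕ)} (h : dcClosed V γ S)
    {q : Q} {x y : ℕ} (hx : (q, x) ∈ ConfPlus V γ) (hxy : Linked V γ q x y)
    (hy : (q, y) ∈ S) : (q, x) ∈ S := by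
  have hC := isChainIn_linked hγ hx
  exact h _ ⟨q, _, hx.1, Nat.mod_lt _ (hγ.Wnat_pos hx.1), hC⟩ (q, y)
    ⟨hy, ⟨mem_ConfPlus_of_le hx hxy.1, rfl, hxy.2.1.symm⟩, Or.inr hxy⟩ (q, x)
    ⟨⟨hx, rfl, rfl⟩, Or.inl (Linked.refl _ _)⟩ hxy.1

theorem U_zero_of_linked (hγ : GammaChoice V γ) {q : Q} {x y : ℕ}
    (hx : (q, x) ∈ ConfPlus V γ) (hxy : Linked V γ q x y) (hy : (q, y) ∈ U V γ 0) :
    (q, x) ∈ U V γ 0 := by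
  rw [mem_U_zero_iff hγ] at hy ⊢
  refine ⟨hx, fun u hu hr => ?_⟩
  rcases Nat.lt_or_ge u y with h | h
  · exact hxy.2.2 u hu h hr
  · exact hy.2 u h (hr.trans hxy.2.1)

theorem U_subset_succ (n : ℕ) : U V γ n ⊆ U V γ (n + 1) :=
  fun _ hc _ hS => hS.1 (Or.inl hc)

theorem U_mono {m n : ℕ} (h : m ≤ n) : U V γ m ⊆ U V γ n :=
  monotone_nat_of_le_succ (f := U V γ) U_subset_succ h

theorem Uprime_subset_U_succ (n : ℕ) : Uprime V γ (U V γ n) ⊆ U V γ (n + 1) :=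
  fun _ hc _ hS => hS.1 (Or.inr hc)

theorem U_of_linked (hγ : GammaChoice V γ) (n : ℕ) {q : Q} {x y : ℕ}
    (hx : (q, x) ∈ ConfPlus V γ) (hxy : Linked V γ q x y) (hy : (q, y) ∈ U V γ n) :
    (q, x) ∈ U V γ n := by
  cases n with
  | zero => exact U_zero_of_linked hγ hx hxy hy
  | succ n => exact fun S hS => hS.2.mem_of_linked hγ hx hxy (hy S hS)

/-- Every new configuration of `U (n + 1)` lies below an element of `U'_n` in its chain. -/
theorem exists_Uprime_of_mem_U_succ (hγ : GammaChoice V γ) (n : ℕ) {q : Q} {x : ℕ}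
    (hx : (q, x) ∈ U V γ (n + 1)) (hx' : (q, x) ∉ U V γ n) :
    (q, x) ∈ ConfPlus V γ ∧ ∃ y, Linked V γ q x y ∧ (q, y) ∈ Uprime V γ (U V γ n) := by
  have := hx ({c | c ∈ U V γ n ∨ c ∈ ConfPlus V γ ∧
    ∃ y, Linked V γ c.1 c.2 y ∧ (c.1, y) ∈ Uprime V γ (U V γ n)}) ⟨?_, ?_⟩
  · exact this.resolve_left hx'
  · rintro c (hc | hc)
    · exact Or.inl hc
    · exact Or.inr ⟨hc.1.1, c.2, Linked.refl _ _, hc⟩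
  · apply dcClosed_of_linked hγ
    rintro q x y hx hxy (h | ⟨_, z, hz, hz'⟩)
    · exact Or.inl (U_of_linked hγ n hx hxy h)
    · exact Or.inr ⟨hx, z, hxy.trans hz, hz'⟩

theorem U_subset_ConfPlus (hγ : GammaChoice V γ) (n : ℕ) : U V γ n ⊆ ConfPlus V γ := by
  induction n with
  | zero => exact fun ⟨q, x⟩ h => ((mem_U_zero_iff hγ).1 h).1
  | succ n ih =>
    rintro ⟨q, x⟩ h
    by_cases h' : (q, x) ∈ U V γ n
    · exact ih h'
    · exact (exists_Uprime_of_mem_U_succ hγ n h h').1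

theorem mem_U_succ_of_runLenTo {n k j : ℕ} {c c' : Q × ℕ}
    (hc : c ∈ Uprime V γ (U V γ n))
    (hc' : c' ∈ ConfPlus V γ) (hj : RunLenTo V c' (U V γ n) j)
    (hmin : ∀ i, RunLenTo V c (U V γ n) i → k ≤ i) (hjk : j ≤ k) : c' ∈ U V γ (n + 1) := by
  by_cases h : c' ∈ U V γ n
  · exact U_subset_succ n h
  obtain ⟨_, k', hk', hk''⟩ := hc
  refine Uprime_subset_U_succ n ⟨⟨hc', h⟩, j, hj, fun d hd i hi => ?_⟩
  have := hk'' d hd i hi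
  have := hmin k' hk'
  omega

end GammaChoice

/-! ### Shortening runs by cutting nonpositive cycles -/

/-- Equal states carry nonincreasing counter values. -/
def NoGain (c d : Q × ℕ) : Prop :=
  d.1 = c.1 → d.2 ≤ c.2

theorem exists_cut (V : OneVASS Q) (L : List (Q × ℕ)) (i j : ℕ) (hij : i < j)
    (hj : j < L.length) (hs : (L[i]'(hij.trans hj)).1 = L[j].1)
    (hc : List.IsChain (LossyStep V) L) (hp : L.Pairwise NoGain) :
    ∃ L' : List (Q × ℕ), L'.length < L.length ∧ L'.head? = L.head? ∧
      List.IsChain (LossyStep V) L' ∧ L'.Pairwise NoGain ∧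
      (∀ d, L.getLast? = some d → ∃ d', L'.getLast? = some d' ∧ d'.1 = d.1 ∧ d.2 ≤ d'.2) ∧
      pathWeight V (L'.map Prod.fst) = pathWeight V (L.map Prod.fst) -
        (pathWeight V ((L.take (j + 1)).map Prod.fst) -
          pathWeight V ((L.take (i + 1)).map Prod.fst)) := by
  have hi : i < L.length := hij.trans hj
  obtain ⟨A, x, M, y, B, hL, hti, htj, hxs⟩ : ∃ (A : List (Q × ℕ)) (x : Q × ℕ)
      (M : List (Q × ℕ)) (y : Q × ℕ) (B : List (Q × ℕ)), L = A ++ x :: (M ++ y :: B) ∧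
      L.take (i + 1) = A ++ [x] ∧ L.take (j + 1) = A ++ x :: (M ++ [y]) ∧ x.1 = y.1 := by
    have h1 : L = L.take j ++ L[j] :: L.drop (j + 1) := by
      rw [← List.drop_eq_getElem_cons hj, List.take_append_drop]
    have h2 : L.take j = L.take i ++ L[i] :: (L.take j).drop (i + 1) := by
      have hi' : i < (L.take j).length := by simp [hij, hi]
      have h3 := List.drop_eq_getElem_cons hi'
      have h4 := List.take_append_drop i (L.take j)
      rw [h3, List.take_take, min_eq_left hij.le, List.getElem_take] at h4
      exact h4.symm
    refine ⟨L.take i, L[i], (L.take j).drop (i + 1), L[j], L.drop (j + 1), ?_, ?_, ?_, hs⟩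
    · conv_lhs => rw [h1, h2]
      simp
    · simp
    · rw [← List.take_concat_get' L j hj]
      conv_lhs => rw [h2]
      simp
  rw [hti, htj]
  subst hL
  have hyx : y.2 ≤ x.2 := by
    rw [List.pairwise_append, List.pairwise_cons] at hp
    exact hp.2.1.1 y (by simp) hxs.symm
  refine ⟨A ++ x :: B, by simp, by cases A <;> simp, ?_, ?_, ?_, ?_⟩
  · rw [List.isChain_split] at hc ⊢
    refine ⟨hc.1, ?_⟩
    have h1 := (List.isChain_split.1 (by simpa using hc.2 :
      List.IsChain (LossyStep V) ((x :: M) ++ y :: B))).2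
    rw [List.isChain_cons] at h1 ⊢
    refine ⟨fun b hb => ?_, h1.2⟩
    have h2 := h1.1 b hb
    refine ⟨hxs ▸ h2.1, ?_⟩
    rw [hxs]
    have := h2.2
    omega
  · refine hp.sublist (List.Sublist.append (List.Sublist.refl A)
      (List.Sublist.cons_cons x ?_))
    exact (List.sublist_cons_self y B).trans (List.sublist_append_right M _)
  · intro d hd
    rw [List.getLast?_append] at hd ⊢
    cases B with
    | nil =>
      have : d = y := by
        rw [← List.cons_append, List.getLast?_append] at hd
        simpa using hd.symm
      subst this
      exact ⟨x, by simp, hxs, hyx⟩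
    | cons b B =>
      refine ⟨d, ?_, rfl, le_rfl⟩
      rw [← List.cons_append, List.getLast?_append, List.getLast?_cons_cons] at hd
      rw [List.getLast?_cons_cons]
      rw [List.getLast?_eq_some_getLast (List.cons_ne_nil b B)] at hd ⊢
      simpa using hd
  · simp only [List.map_append, List.map_cons, List.map_nil]
    have h1 := pathWeight_append_cons V (A.map Prod.fst) x.1 (B.map Prod.fst)
    have h2 := pathWeight_append_cons V (A.map Prod.fst ++ x.1 :: M.map Prod.fst) y.1
      (B.map Prod.fst)
    simp only [List.append_assoc, List.cons_append] at h2
    rw [h1, h2, hxs]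
    ring

theorem exists_nodup_lossy (V : OneVASS Q) (L : List (Q × ℕ))
    (hc : List.IsChain (LossyStep V) L) (hp : L.Pairwise NoGain) (d : Q × ℕ)
    (hd : L.getLast? = some d) :
    ∃ L' : List (Q × ℕ), L'.head? = L.head? ∧ List.IsChain (LossyStep V) L' ∧
      (L'.map Prod.fst).Nodup ∧ ∃ d', L'.getLast? = some d' ∧ d'.1 = d.1 ∧ d.2 ≤ d'.2 := by
  induction hn : L.length using Nat.strong_induction_on generalizing L d with
  | _ n ih =>
  by_cases hnd : (L.map Prod.fst).Nodup
  · exact ⟨L, rfl, hc, hnd, d, hd, rfl, le_rfl⟩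
  · rw [List.Nodup, List.pairwise_map, List.pairwise_iff_getElem] at hnd
    push Not at hnd
    obtain ⟨i, j, hi, hj, hij, hs⟩ := hnd
    obtain ⟨L1, h1, h2, h3, h4, h5, _⟩ := exists_cut V L i j hij hj hs hc hp
    obtain ⟨d1, h6, h7, h8⟩ := h5 d hd
    obtain ⟨L', h9, h10, h11, d', h12, h13, h14⟩ := ih _ (hn ▸ h1) L1 h3 h4 d1 h6 rfl
    exact ⟨L', h9.trans h2, h10, h11, d', h12, h13.trans h7, h8.trans h14⟩

theorem toNat_mod_congr {a b : ℤ} (ha : 0 ≤ a) (hb : 0 ≤ b) {W : ℕ}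
    (h : (W : ℤ) ∣ b - a) : a.toNat % W = b.toNat % W := by
  have h1 : ((a.toNat : ℕ) : ℤ) ≡ (b.toNat : ℕ) [ZMOD W] := by
    rw [Int.toNat_of_nonneg ha, Int.toNat_of_nonneg hb]
    exact Int.modEq_iff_dvd.2 h
  exact Int.natCast_modEq_iff.1 h1

theorem dvd_of_toNat_mod_eq {a b : ℤ} (ha : 0 ≤ a) (hb : 0 ≤ b) {W : ℕ}
    (h : a.toNat % W = b.toNat % W) : (W : ℤ) ∣ b - a := by
  have h1 : ((a.toNat : ℕ) : ℤ) ≡ (b.toNat : ℕ) [ZMOD W] := Int.natCast_modEq_iff.2 h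
  rw [Int.toNat_of_nonneg ha, Int.toNat_of_nonneg hb] at h1
  exact Int.modEq_iff_dvd.1 h1

/-- A path without gainful cycles can be shortened to polynomial length while keeping its final
residue modulo `W`, or else reaching a residue outside the set `bad`. -/
theorem exists_short_lossy [Fintype Q] (V : OneVASS Q) (c : Q × ℕ) (L : List (Q × ℕ))
    (hc : List.IsChain (LossyStep V) (c :: L)) (hp : L.Pairwise NoGain) (d : Q × ℕ)
    (hd : L.getLast? = some d) (W N : ℕ) (bad : Finset ℕ) (hbad : bad.card ≤ N) :
    ∃ L' : List (Q × ℕ), List.IsChain (LossyStep V) (c :: L') ∧ L'.length ≤ L.length ∧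
      L'.length ≤ Fintype.card Q * (N + 1) ∧
      (∃ d', L'.getLast? = some d' ∧ d'.1 = d.1 ∧ d.2 ≤ d'.2) ∧
      (((c.2 : ℤ) + pathWeight V (c.1 :: L'.map Prod.fst)).toNat % W =
          ((c.2 : ℤ) + pathWeight V (c.1 :: L.map Prod.fst)).toNat % W ∨
        ((c.2 : ℤ) + pathWeight V (c.1 :: L'.map Prod.fst)).toNat % W ∉ bad) := by
  classical
  induction hn : L.length using Nat.strong_induction_on generalizing L d with
  | _ n ih =>
  by_cases hlen : L.length ≤ Fintype.card Q * (N + 1)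
  · exact ⟨L, hc, hn.le, hlen, ⟨d, hd, rfl, le_rfl⟩, Or.inl rfl⟩
  set val : List (Q × ℕ) → ℤ := fun L => (c.2 : ℤ) + pathWeight V (c.1 :: L.map Prod.fst)
    with hval
  set pw : ℕ → ℤ := fun i => pathWeight V ((L.take (i + 1)).map Prod.fst) with hpw
  have cut : ∀ i j : ℕ, ∀ hij : i < j, ∀ hj : j < L.length,
      (L[i]'(hij.trans hj)).1 = L[j].1 →
      ∃ L1 : List (Q × ℕ), L1.length < L.length ∧ List.IsChain (LossyStep V) (c :: L1) ∧
        L1.Pairwise NoGain ∧ (∃ d1, L1.getLast? = some d1 ∧ d1.1 = d.1 ∧ d.2 ≤ d1.2) ∧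
        val L1 = val L - (pw j - pw i) ∧ 0 ≤ val L1 := by
    intro i j hij hj hs
    obtain ⟨L1, h1, h2, h3, h4, h5, h6⟩ := exists_cut V L i j hij hj hs hc.tail hp
    obtain ⟨d1, h7, h8⟩ := h5 d hd
    have hc1 : List.IsChain (LossyStep V) (c :: L1) := by
      rw [List.isChain_cons] at hc ⊢
      exact ⟨by rw [h2]; exact hc.1, h3⟩
    obtain ⟨b, A, rfl⟩ : ∃ b A, L = b :: A := List.exists_cons_of_length_pos (by omega)
    obtain ⟨A1, rfl⟩ : ∃ A1, L1 = b :: A1 := List.head?_eq_some_iff.1 (by simpa using h2)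
    refine ⟨_, h1, hc1, h4, ⟨d1, h7, h8⟩, ?_, ?_⟩
    · simp only [List.map_cons] at h6
      simp only [hval, hpw, List.map_cons, pathWeight_cons_cons V c.1]
      rw [h6]; ring
    · have := (isRun_of_lossy V c.1 c.2 _ hc1 d1
        (by rwa [List.getLast?_cons_cons]) c.2 le_rfl).2
      simp only [hval]; omega
  have hval0 : 0 ≤ val L := by
    obtain ⟨b, A, rfl⟩ : ∃ b A, L = b :: A := List.exists_cons_of_length_pos (by omega)
    have := (isRun_of_lossy V c.1 c.2 _ hc d
      (by rwa [List.getLast?_cons_cons]) c.2 le_rfl).2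
    simp only [hval]; omega
  have finish : ∀ L1 : List (Q × ℕ), L1.length < L.length →
      List.IsChain (LossyStep V) (c :: L1) → L1.Pairwise NoGain →
      (∃ d1, L1.getLast? = some d1 ∧ d1.1 = d.1 ∧ d.2 ≤ d1.2) →
      ((val L1).toNat % W = (val L).toNat % W ∨ (val L1).toNat % W ∉ bad) →
      ∃ L' : List (Q × ℕ), List.IsChain (LossyStep V) (c :: L') ∧ L'.length ≤ n ∧
        L'.length ≤ Fintype.card Q * (N + 1) ∧
        (∃ d', L'.getLast? = some d' ∧ d'.1 = d.1 ∧ d.2 ≤ d'.2) ∧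
        ((val L').toNat % W = (val L).toNat % W ∨ (val L').toNat % W ∉ bad) := by
    rintro L1 h1 h2 h3 ⟨d1, h4, h5, h6⟩ h7
    obtain ⟨L', g1, g2, g3, ⟨d', g4, g5, g6⟩, g7⟩ := ih _ (hn ▸ h1) L1 h2 h3 d1 h4 rfl
    refine ⟨L', g1, by omega, g3, ⟨d', g4, g5.trans h5, h6.trans g6⟩, ?_⟩
    rcases g7 with g7 | g7
    · change (val L').toNat % W = (val L1).toNat % W at g7
      rw [g7]; exact h7
    · exact Or.inr g7
  obtain ⟨s, -, hs⟩ := Finset.exists_lt_card_fiber_of_mul_lt_card_of_maps_to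
    (s := (Finset.univ : Finset (Fin L.length))) (t := (Finset.univ : Finset Q))
    (f := fun i => (L[i]).1) (n := N + 1) (fun _ _ => Finset.mem_univ _)
    (by simpa using hlen)
  set S := (Finset.univ : Finset (Fin L.length)).filter fun i => (L[i]).1 = s
  have hSmem : ∀ i ∈ S, (L[i]).1 = s := fun i hi => (Finset.mem_filter.1 hi).2
  have hSne : S.Nonempty := Finset.card_pos.1 (by omega)
  set i0 := S.min' hSne
  have hi0 : i0 ∈ S := S.min'_mem hSne
  have hlt : ∀ i ∈ S.erase i0, i0 < i := fun i hi =>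
    lt_of_le_of_ne (S.min'_le i (Finset.mem_of_mem_erase hi)) (Finset.ne_of_mem_erase hi).symm
  have hnn : ∀ i ∈ S.erase i0, 0 ≤ val L - (pw i - pw i0) := by
    intro i hi
    obtain ⟨L1, -, -, -, -, h5, h6⟩ := cut i0 i (hlt i hi) i.2
      ((hSmem i0 hi0).trans (hSmem i (Finset.mem_of_mem_erase hi)).symm)
    omega
  by_cases hmaps : ∀ i ∈ S.erase i0, (val L - (pw i - pw i0)).toNat % W ∈ bad
  · obtain ⟨i, hi, j, hj, hne, hij⟩ := Finset.exists_ne_map_eq_of_card_lt_of_maps_to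
      (s := S.erase i0) (t := bad)
      (by rw [Finset.card_erase_of_mem hi0]; omega) (fun i hi => hmaps i hi)
    have main : ∀ i ∈ S.erase i0, ∀ j ∈ S.erase i0, i < j →
        (val L - (pw i - pw i0)).toNat % W = (val L - (pw j - pw i0)).toNat % W →
        ∃ L' : List (Q × ℕ), List.IsChain (LossyStep V) (c :: L') ∧ L'.length ≤ n ∧
          L'.length ≤ Fintype.card Q * (N + 1) ∧
          (∃ d', L'.getLast? = some d' ∧ d'.1 = d.1 ∧ d.2 ≤ d'.2) ∧
          ((val L').toNat % W = (val L).toNat % W ∨ (val L').toNat % W ∉ bad) := by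
      intro i hi j hj hlt hij
      obtain ⟨L1, h1, h2, h3, h4, h5, h6⟩ := cut i j hlt j.2
        ((hSmem i (Finset.mem_of_mem_erase hi)).trans
          (hSmem j (Finset.mem_of_mem_erase hj)).symm)
      refine finish L1 h1 h2 h3 h4 (Or.inl (toNat_mod_congr h6 hval0 ?_))
      have := dvd_of_toNat_mod_eq (hnn j hj) (hnn i hi) hij.symm
      convert this using 1
      rw [h5]; ring
    rcases lt_or_gt_of_ne hne with h | h
    · exact main i hi j hj h hij
    · exact main j hj i hi h hij.symm
  · push Not at hmaps
    obtain ⟨i, hi, hb⟩ := hmaps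
    obtain ⟨L1, h1, h2, h3, h4, h5, h6⟩ := cut i0 i (hlt i hi) i.2
      ((hSmem i0 hi0).trans (hSmem i (Finset.mem_of_mem_erase hi)).symm)
    exact finish L1 h1 h2 h3 h4 (Or.inr (h5 ▸ hb))

/-! ### Descending along shortest runs -/

section Descent

variable {V : OneVASS Q} {γ : Q → List Q}

theorem mem_ConfPlus_of_gain (hγ : GammaChoice V γ) (a b : Q × ℕ) (M : List (Q × ℕ))
    (hc : List.IsChain (ConfStep V) (a :: (M ++ [b]))) (hp : (a :: M).Pairwise NoGain)
    (hs : b.1 = a.1) (hlt : a.2 < b.2) : a ∈ ConfPlus V γ := by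
  have hc1 : List.IsChain (ConfStep V) ((a :: M) ++ [b]) := hc
  rw [List.isChain_append] at hc1
  obtain ⟨d, hd⟩ : ∃ d, (a :: M).getLast? = some d :=
    ⟨_, List.getLast?_eq_some_getLast (List.cons_ne_nil a M)⟩
  have hdb : ConfStep V d b := hc1.2.2 d hd b rfl
  obtain ⟨L', h1, h2, h3, d', h4, h5, h6⟩ := exists_nodup_lossy V (a :: M)
    (hc1.1.imp fun _ _ h => h.lossy) hp d hd
  obtain ⟨T, rfl⟩ : ∃ T, L' = a :: T := List.head?_eq_some_iff.1 (by simpa using h1)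
  have hc2 : List.IsChain (LossyStep V) (a :: (T ++ [b])) := by
    have : List.IsChain (LossyStep V) ((a :: T) ++ [b]) := by
      rw [List.isChain_append]
      refine ⟨h2, List.isChain_singleton _, ?_⟩
      intro x hx y hy
      obtain rfl : d' = x := by simpa [h4] using hx
      obtain rfl : b = y := by simpa using hy
      have h7 := hdb.lossy
      refine ⟨h5 ▸ h7.1, ?_⟩
      have := h7.2
      rw [h5]
      omega
    exact this
  have hrun := isRun_of_lossy V a.1 a.2 (T ++ [b]) hc2 b
    (by rw [← List.cons_append, List.getLast?_append]; simp) a.2 le_rfl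
  set σ := a.1 :: (T ++ [b]).map Prod.fst with hσ
  have hpos : 0 < pathWeight V σ := by have := hrun.2; omega
  have hsimple : IsSimpleCycleOn V σ a.1 := by
    refine ⟨⟨hrun.1.1, by simp [hσ], by simp [hσ], ?_⟩, ?_⟩
    · rw [hσ, List.map_append, ← List.cons_append, List.getLast?_append]
      simp [hs]
    · have : σ.dropLast = (a :: T).map Prod.fst := by
        rw [hσ, List.map_append, ← List.cons_append]
        simp only [List.map_cons, List.map_nil, List.dropLast_concat]
      rw [this]
      exact h3
  have hq : a.1 ∈ Qplus V := ⟨σ, hsimple, hpos⟩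
  have h8 := (hγ a.1 hq).2.2 σ hsimple hpos
  have h9 := (isRun_iff_pmin hrun.1.1 a.2).1 hrun.1
  exact ⟨hq, by omega⟩

theorem pairwise_noGain_of_not_mem_ConfPlus (hγ : GammaChoice V γ) (L : List (Q × ℕ))
    (hc : List.IsChain (ConfStep V) L) (hL : ∀ d ∈ L.dropLast, d ∉ ConfPlus V γ) :
    L.Pairwise NoGain := by
  induction hn : L.length using Nat.strong_induction_on generalizing L with
  | _ n ih =>
  rcases L with _ | ⟨a, L⟩
  · exact List.Pairwise.nil
  rcases List.eq_nil_or_concat' L with rfl | ⟨M, b, rfl⟩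
  · exact List.pairwise_singleton _ _
  have hdl : (a :: (M ++ [b])).dropLast = a :: M := by
    rw [← List.cons_append, List.dropLast_concat]
  rw [hdl] at hL
  have hc1 : List.IsChain (ConfStep V) ((a :: M) ++ [b]) := hc
  have h1 : (a :: M).Pairwise NoGain :=
    ih _ (by simp at hn ⊢; omega) _ (List.isChain_append.1 hc1).1
      (fun d hd => hL d (List.mem_of_mem_dropLast hd)) rfl
  have h2 : (M ++ [b]).Pairwise NoGain :=
    ih _ (by simp at hn ⊢; omega) _ hc.tail
      (fun d hd => hL d (by rw [List.dropLast_concat] at hd; simp [hd])) rfl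
  rw [List.pairwise_cons] at h1 ⊢
  refine ⟨fun d hd => ?_, h2⟩
  rcases List.mem_append.1 hd with hd | hd
  · exact h1.1 d hd
  · obtain rfl : d = b := by simpa using hd
    intro hs
    by_contra! hlt
    exact hL a (by simp) (mem_ConfPlus_of_gain hγ a d M hc (List.pairwise_cons.2 h1) hs hlt)

/-- From a configuration at minimal distance to `U n`, a short path leads to the height of a
configuration of `U n`, up to residue; translates of this path show membership in `U (n + 1)`
except for a few blocked translates. -/
theorem exists_descent [Fintype Q] (hV : SingleGuard V) (hγ : GammaChoice V γ) {N : ℕ}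
    (BF : Q → Finset ℕ) (hN : ∀ q ∈ Qplus V, (BF q).card ≤ N) (n : ℕ) {q : Q} {y : ℕ}
    (h : (q, y) ∈ Uprime V γ (U V γ n)) :
    ∃ (p : Q) (z e : ℕ) (F : Finset ℕ), (p, z) ∈ U V γ n ∧ z ≤ e ∧
      F.card ≤ Fintype.card Q * (N + 1) + 1 ∧
      (e % Wnat V γ p = z % Wnat V γ p ∨
        e % Wnat V γ p ∉ (BF p).image (· % Wnat V γ p)) ∧
      ∀ i, y + i ∉ F → (p, e + i) ∈ U V γ n → (q, y + i) ∈ U V γ (n + 1) := by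
  classical
  obtain ⟨⟨hyC, hyU⟩, k, hk, hkmin⟩ := id h
  obtain ⟨L, hLk, hc, hv, d, hdU, hd⟩ := (runLenTo_iff V _ _ _).1 hk
  have hmin : ∀ i, RunLenTo V (q, y) (U V γ n) i → k ≤ i := hkmin _ ⟨hyC, hyU⟩
  have hLne : L ≠ [] := by
    rintro rfl
    obtain rfl : (q, y) = d := by simpa using hd
    exact hyU hdU
  have hd' : L.getLast? = some d := by
    obtain ⟨b, A, rfl⟩ := List.exists_cons_of_ne_nil hLne
    rwa [List.getLast?_cons_cons] at hd
  have hnot : ∀ c ∈ L.dropLast, c ∉ ConfPlus V γ := by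
    intro c hcm hcC
    obtain ⟨A, B, hAB⟩ := List.append_of_mem hcm
    have hL : L = A ++ c :: (B ++ [d]) := by
      have := List.dropLast_append_getLast? (l := L) d hd'
      rw [← this, hAB]; simp
    have hlen : L.length = A.length + (B.length + 1) + 1 := by simp [hL]; omega
    have hc' : List.IsChain (ConfStep V) (((q, y) :: A) ++ c :: (B ++ [d])) := by
      rw [List.cons_append, ← hL]; exact hc
    by_cases hcU : c ∈ U V γ n
    · have : RunLenTo V (q, y) (U V γ n) (A.length + 1) := by
        refine (runLenTo_iff V _ _ _).2 ⟨A ++ [c], by simp, (List.isChain_split.1 hc').1,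
          fun x hx => hv x ?_, c, hcU, ?_⟩
        · rw [hL]; simp at hx ⊢; tauto
        · rw [← List.cons_append, List.getLast?_append]; simp
      have := hmin _ this
      omega
    · have : RunLenTo V c (U V γ n) (B.length + 1) := by
        refine (runLenTo_iff V _ _ _).2 ⟨B ++ [d], by simp, (List.isChain_split.1 hc').2,
          fun x hx => hv x ?_, d, hdU, ?_⟩
        · rw [hL]; simp at hx ⊢; tauto
        · rw [← List.cons_append, List.getLast?_append]; simp
      have := hkmin c ⟨hcC, hcU⟩ _ this
      omega
  have hp := pairwise_noGain_of_not_mem_ConfPlus hγ L hc.tail hnot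
  have hpU : d ∈ ConfPlus V γ := U_subset_ConfPlus hγ n hdU
  obtain ⟨L', g1, g2, g3, ⟨d', g4, g5, g6⟩, g7⟩ := exists_short_lossy V (q, y) L
    (hc.imp fun _ _ h => h.lossy) hp d hd' (Wnat V γ d.1) N
    ((BF d.1).image (· % Wnat V γ d.1))
    (Finset.card_image_le.trans (hN d.1 hpU.1))
  have hdval := (isValidRun_of_configs V q y L hc hv d hd).2.2
  have hne' : L' ≠ [] := by rintro rfl; simp at g4
  have hlast' : ((q, y) :: L').getLast? = some d' := by
    obtain ⟨b, A, rfl⟩ := List.exists_cons_of_ne_nil hne'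
    rwa [List.getLast?_cons_cons]
  have hrun := isRun_of_lossy V q y L' g1 d' hlast'
  obtain ⟨F, hF, hFv⟩ := exists_blocked_finset hV (q :: L'.map Prod.fst)
  set e : ℤ := (y : ℤ) + pathWeight V (q :: L'.map Prod.fst) with he
  have he0 : (d'.2 : ℤ) ≤ e := (hrun y le_rfl).2
  refine ⟨d.1, d.2, e.toNat, F, hdU, by omega, ?_, ?_, ?_⟩
  · simp only [List.length_cons, List.length_map] at hF
    omega
  · rw [← hdval] at g7
    simpa using g7
  · intro i hiF hi
    refine mem_U_succ_of_runLenTo h (mem_ConfPlus_of_le hyC (Nat.le_add_right y i)) (j := L'.length)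
      ⟨q :: L'.map Prod.fst, (d.1, e.toNat + i), hi, ?_, ⟨rfl, ?_, ?_⟩, by simp⟩ hmin
      (by omega)
    · exact hFv _ (hrun (y + i) (by omega)).1 hiF
    · have : ((q, y) :: L').map Prod.fst = q :: L'.map Prod.fst := rfl
      rw [← this, List.getLast?_map, hlast']
      simp [g5]
    · push_cast
      rw [Int.toNat_of_nonneg (by omega)]
      omega

end Descent

/-! ### Counting configurations outside `U n` -/

theorem exists_dvd_of_residues_mem {x s W N : ℕ} {B : Finset ℕ} (hB : B.card ≤ N)
    (h : ∀ j ≤ N, (x + j * s) % W ∈ B) : ∃ t, 0 < t ∧ t ≤ N ∧ W ∣ t * s := by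
  obtain ⟨i, hi, j, hj, hne, hij⟩ := Finset.exists_ne_map_eq_of_card_lt_of_maps_to
    (s := Finset.range (N + 1)) (t := B) (f := fun j => (x + j * s) % W)
    (by simpa using Nat.lt_succ_of_le hB)
    (fun j hj => h j (by simpa [Nat.lt_succ_iff] using hj))
  rw [Finset.mem_range] at hi hj
  have main : ∀ i j, i < j → j ≤ N → (x + i * s) % W = (x + j * s) % W →
      ∃ t, 0 < t ∧ t ≤ N ∧ W ∣ t * s := by
    intro i j hlt hj hij
    refine ⟨j - i, by omega, by omega, ?_⟩
    have h1 := (Nat.modEq_iff_dvd' (by gcongr)).1 hij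
    rwa [Nat.add_sub_add_left, ← Nat.sub_mul] at h1
  rcases lt_or_gt_of_ne hne with hlt | hlt
  · exact main i j hlt (by omega) hij
  · exact main j i hlt (by omega) hij.symm

section Counting

variable {V : OneVASS Q} {γ : Q → List Q}

/-- `BF q` contains all values at which the cycle `γ q` can be fired but violates a guard. -/
def BlocksCycles (V : OneVASS Q) (γ : Q → List Q) (BF : Q → Finset ℕ) : Prop :=
  ∀ q x, (q, x) ∈ ConfPlus V γ → x ∉ BF q → IsValidRun V (γ q) x

theorem exists_blocksCycles [Fintype Q] (hV : SingleGuard V) (hγ : GammaChoice V γ) :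
    ∃ BF : Q → Finset ℕ, BlocksCycles V γ BF ∧ ∀ q, (BF q).card ≤ Fintype.card Q + 1 := by
  classical
  have key : ∀ q, ∃ F : Finset ℕ, F.card ≤ Fintype.card Q + 1 ∧
      ∀ x, (q, x) ∈ ConfPlus V γ → x ∉ F → IsValidRun V (γ q) x := by
    intro q
    by_cases hq : q ∈ Qplus V
    · obtain ⟨F, hF, hFv⟩ := exists_blocked_finset hV (γ q)
      obtain ⟨⟨hcyc, hnd⟩, -, -⟩ := hγ q hq
      refine ⟨F, hF.trans ?_, fun x hx hxF => hFv x ((isRun_iff_pmin hcyc.1 x).2 hx.2) hxF⟩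
      have := hnd.length_le_card
      rw [List.length_dropLast] at this
      omega
    · exact ⟨∅, by simp, fun x hx => absurd hx.1 hq⟩
  choose BF h1 h2 using key
  exact ⟨BF, h2, h1⟩

theorem BlocksCycles.linked {BF : Q → Finset ℕ} (hB : BlocksCycles V γ BF) {q : Q} {x y : ℕ}
    (hx : (q, x) ∈ ConfPlus V γ) (hxy : x ≤ y) (hr : x % Wnat V γ q = y % Wnat V γ q)
    (h : ∀ u ∈ BF q, x ≤ u → y ≤ u) : Linked V γ q x y := by
  refine ⟨hxy, hr, fun u hu huy _ => hB q u (mem_ConfPlus_of_le hx hu) fun hb => ?_⟩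
  have := h u hb hu
  omega

theorem BlocksCycles.mem_U_zero {BF : Q → Finset ℕ} (hB : BlocksCycles V γ BF)
    (hγ : GammaChoice V γ) {q : Q} {x : ℕ} (hx : (q, x) ∈ ConfPlus V γ)
    (h : x % Wnat V γ q ∉ (BF q).image (· % Wnat V γ q)) : (q, x) ∈ U V γ 0 := by
  refine (mem_U_zero_iff hγ).2 ⟨hx, fun u hu hr => hB q u (mem_ConfPlus_of_le hx hu) ?_⟩
  intro hb
  exact h (Finset.mem_image.2 ⟨u, hb, hr⟩)

open Classical in
/-- The blocked cycle positions that end the chain of some configuration of `U m`. -/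
noncomputable def blockedEnds [Fintype Q] (V : OneVASS Q) (γ : Q → List Q) (BF : Q → Finset ℕ)
    (m : ℕ) : Finset (Σ _ : Q, ℕ) :=
  ((Finset.univ : Finset Q).sigma BF).filter fun s =>
    ¬ IsValidRun V (γ s.1) s.2 ∧ ∃ x, (s.1, x) ∈ U V γ m ∧ Linked V γ s.1 x s.2

theorem card_blockedEnds_le [Fintype Q] {BF : Q → Finset ℕ} {N : ℕ}
    (hN : ∀ q, (BF q).card ≤ N) (m : ℕ) :
    (blockedEnds V γ BF m).card ≤ Fintype.card Q * N := by
  classical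
  refine (Finset.card_le_card (show blockedEnds V γ BF m ⊆ Finset.univ.sigma BF from
    fun s hs => (Finset.mem_filter.1 hs).1)).trans ?_
  rw [Finset.card_sigma]
  simpa using Finset.sum_le_card_nsmul Finset.univ (fun q => (BF q).card) N fun q _ => hN q

theorem exists_first_stage [Fintype Q] {BF : Q → Finset ℕ} (hB : BlocksCycles V γ BF)
    (hγ : GammaChoice V γ) {m : ℕ} {q : Q} {z : ℕ} (hz : (q, z) ∈ U V γ m) :
    (∀ e, z ≤ e → e % Wnat V γ q = z % Wnat V γ q → (q, e) ∈ U V γ m) ∨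
    ∃ n v y, n < m ∧ (blockedEnds V γ BF n).card < (blockedEnds V γ BF m).card ∧
      v ≤ z ∧ v % Wnat V γ q = z % Wnat V γ q ∧ (q, v) ∈ ConfPlus V γ ∧
      Linked V γ q v y ∧ (q, y) ∈ Uprime V γ (U V γ n) := by
  classical
  set P : ℕ → Prop := fun x => (q, x) ∈ U V γ m ∧ x % Wnat V γ q = z % Wnat V γ q with hP
  have hex : ∃ x, P x := ⟨z, hz, rfl⟩
  set v := Nat.find hex with hv
  obtain ⟨hvU, hvr⟩ : P v := Nat.find_spec hex
  have hvmin : ∀ x, P x → v ≤ x := fun x hx => Nat.find_min' hex hx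
  have hvz : v ≤ z := hvmin z ⟨hz, rfl⟩
  have hvC := U_subset_ConfPlus hγ m hvU
  by_cases hv0 : (q, v) ∈ U V γ 0
  · left
    intro e hze hr
    refine U_mono (Nat.zero_le m) ((mem_U_zero_iff hγ).2
      ⟨mem_ConfPlus_of_le hvC (hvz.trans hze), fun u hu hur => ?_⟩)
    exact ((mem_U_zero_iff hγ).1 hv0).2 u (by omega) (by rw [hur, hr, hvr])
  right
  have hexs : ∃ k, (q, v) ∈ U V γ k := ⟨m, hvU⟩
  obtain ⟨n, hn⟩ : ∃ n, Nat.find hexs = n + 1 := Nat.exists_eq_succ_of_ne_zero fun h0 =>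
    hv0 (h0 ▸ Nat.find_spec hexs)
  have hn1 : (q, v) ∈ U V γ (n + 1) := hn ▸ Nat.find_spec hexs
  have hn2 : (q, v) ∉ U V γ n := Nat.find_min hexs (by omega)
  have hnm : n < m := by have := Nat.find_min' hexs hvU; omega
  obtain ⟨-, y, hvy, hy⟩ := exists_Uprime_of_mem_U_succ hγ n hn1 hn2
  refine ⟨n, v, y, hnm, Finset.card_lt_card ?_, hvz, hvr, hvC, hvy, hy⟩
  have hbl : ∃ u, v ≤ u ∧ u % Wnat V γ q = v % Wnat V γ q ∧ ¬ IsValidRun V (γ q) u := by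
    by_contra! hcon
    exact hv0 ((mem_U_zero_iff hγ).2 ⟨hvC, hcon⟩)
  obtain ⟨hu1, hu2, hu3⟩ := Nat.find_spec hbl
  set u := Nat.find hbl with hu
  have hvu : Linked V γ q v u := by
    refine ⟨hu1, hu2.symm, fun t h1 h2 h3 => ?_⟩
    by_contra hcon
    exact Nat.find_min hbl h2 ⟨h1, by omega, hcon⟩
  rw [Finset.ssubset_iff_of_subset]
  · refine ⟨⟨q, u⟩, ?_, ?_⟩
    · refine Finset.mem_filter.2 ⟨Finset.mem_sigma.2 ⟨Finset.mem_univ _, ?_⟩, hu3, v, hvU, hvu⟩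
      by_contra hb
      exact hu3 (hB q u (mem_ConfPlus_of_le hvC hu1) hb)
    · intro hmem
      obtain ⟨-, -, x, hx, hxu⟩ := Finset.mem_filter.1 hmem
      have hvx : v ≤ x := hvmin x ⟨U_mono hnm.le hx, by rw [hxu.2.1, hu2, hvr]⟩
      exact hn2 (U_of_linked hγ n hvC
        (hvu.of_le_left hvx hxu.1 (by rw [hxu.2.1, hu2])).1 hx)
  · intro s hs
    obtain ⟨h1, h2, x, h3, h4⟩ := Finset.mem_filter.1 hs
    exact Finset.mem_filter.2 ⟨h1, h2, x, U_mono hnm.le h3, h4⟩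

/-- Above a configuration of `U m`, all but boundedly many long windows that contain an
arithmetic progression avoiding `U m` start in `U m`. -/
theorem exists_window_exceptions [Fintype Q] (hV : SingleGuard V) (hγ : GammaChoice V γ)
    {BF : Q → Finset ℕ} (hB : BlocksCycles V γ BF) {N : ℕ} (hN : ∀ q, (BF q).card ≤ N)
    (m : ℕ) {q : Q} {z : ℕ} (hz : (q, z) ∈ U V γ m) :
    ∃ Ev : Finset ℕ,
      Ev.card ≤ ((blockedEnds V γ BF m).card + 1) * (N + (Fintype.card Q * (N + 1) + 1)) ∧
      ∀ e, z ≤ e → e % Wnat V γ q = z % Wnat V γ q → ∀ (M : ℕ) (a : ℤ) (T : ℕ), 0 < M →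
        ((blockedEnds V γ BF m).card + 1) * (N * N + N + 1) * M ≤ T →
        (∀ u ∈ Ev, e ≤ u → e + T < u) →
        (∀ x, e ≤ x → x ≤ e + T → (M : ℤ) ∣ x - a → (q, x) ∉ U V γ m) →
        (q, e) ∈ U V γ m := by
  classical
  induction m using Nat.strong_induction_on generalizing q z with
  | _ m ih =>
  rcases exists_first_stage hB hγ hz with h0 | ⟨n, v, y, hnm, hψ, hvz, hvr, hvC, hvy, hy⟩
  · exact ⟨∅, by simp, fun e he hr _ _ _ _ _ _ _ => h0 e he hr⟩
  obtain ⟨p, z1, e0, F, hz1, hze0, hF, hres, hdesc⟩ :=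
    exists_descent hV hγ BF (fun q _ => hN q) n hy
  obtain ⟨Ev', hEv', hwin⟩ := ih n hnm hz1
  have hq : q ∈ Qplus V := hvC.1
  have hz1C := U_subset_ConfPlus hγ n hz1
  refine ⟨BF q ∪ F ∪ Ev'.image (fun u => u + y - e0), ?_, ?_⟩
  · have h1 := Finset.card_union_le (BF q ∪ F) (Ev'.image (fun u => u + y - e0))
    have h2 := Finset.card_union_le (BF q) F
    have h3 := Finset.card_image_le (s := Ev') (f := fun u => u + y - e0)
    have h4 := hN q
    have h5 : ((blockedEnds V γ BF n).card + 1 + 1) * (N + (Fintype.card Q * (N + 1) + 1)) ≤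
      ((blockedEnds V γ BF m).card + 1) * (N + (Fintype.card Q * (N + 1) + 1)) := by
      gcongr; omega
    rw [Nat.succ_mul] at h5
    omega
  intro e hze her M a T hM hT hEv htrack
  by_contra heU
  have hEvB : ∀ u ∈ BF q, e ≤ u → e + T < u := fun u hu => hEv u (by simp [hu])
  have hEvF : ∀ u ∈ F, e ≤ u → e + T < u := fun u hu => hEv u (by simp [hu])
  have hEvI : ∀ u ∈ Ev', e ≤ u + y - e0 → e + T < u + y - e0 := fun u hu =>
    hEv _ (Finset.mem_union_right _ (Finset.mem_image_of_mem _ hu))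
  have heC : (q, e) ∈ ConfPlus V γ := mem_ConfPlus_of_le hvC (hvz.trans hze)
  have hyU : (q, y) ∈ U V γ (n + 1) := Uprime_subset_U_succ n hy
  have hye : y < e := by
    by_contra! hey
    exact heU (U_of_linked hγ m heC
      (hvy.of_le_left (hvz.trans hze) hey (by rw [hvr, her])).2 (U_mono hnm hyU))
  have hT1 : ((blockedEnds V γ BF n).card + 1) * (N * N + N + 1) * M +
      (N * N + N + 1) * M ≤ T := by
    rw [← Nat.add_mul, ← Nat.succ_mul]
    exact (Nat.mul_le_mul_right M (Nat.mul_le_mul_right _ (by omega))).trans hT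
  have hT2 : N * N * M + (N + 1) * M ≤ T := by
    refine le_trans ?_ ((Nat.le_add_left _ _).trans hT1)
    exact le_of_eq (by ring)
  -- the progression bounds the cycle weight at `q`
  have hWM : Wnat V γ q ≤ N * M := by
    obtain ⟨x0, hx0, hx0', hx0d⟩ : ∃ x0 : ℕ, e ≤ x0 ∧ x0 ≤ e + M ∧ (M : ℤ) ∣ x0 - a := by
      have hM' : (0 : ℤ) < M := by exact_mod_cast hM
      have h1 := Int.emod_nonneg (a - e) hM'.ne'
      have h2 := Int.emod_lt_of_pos (a - e) hM'
      refine ⟨e + ((a - e) % M).toNat, by omega, by omega, ?_⟩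
      push_cast
      rw [Int.toNat_of_nonneg h1]
      have h3 := Int.mul_ediv_add_emod (a - e) M
      exact ⟨-((a - e) / M), by linarith⟩
    obtain ⟨t, ht0, htN, htd⟩ := exists_dvd_of_residues_mem (x := x0) (s := M)
      (W := Wnat V γ q) (Finset.card_image_le.trans (hN q)) (fun j hj => by
        by_contra hb
        have h1 : j * M ≤ N * M := Nat.mul_le_mul_right _ hj
        have h2 : (N + 1) * M = N * M + M := Nat.succ_mul _ _
        refine htrack (x0 + j * M) (by omega) (by omega) ?_ (U_mono (Nat.zero_le m)
          (hB.mem_U_zero hγ (mem_ConfPlus_of_le heC (by omega)) hb))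
        push_cast
        obtain ⟨k, hk⟩ := hx0d
        exact ⟨k + j, by rw [mul_add, ← hk]; ring⟩)
    exact (Nat.le_of_dvd (Nat.mul_pos ht0 hM) htd).trans (Nat.mul_le_mul_right _ htN)
  have hjW : ∀ j ≤ N, j * Wnat V γ q ≤ N * N * M := fun j hj => by
    rw [mul_assoc]; exact Nat.mul_le_mul hj hWM
  have hout : ∀ j ≤ N, (p, e0 + (e + j * Wnat V γ q - y)) ∉ U V γ n := by
    intro j hj hmem
    have h1 := hjW j hj
    have h2 := hdesc (e + j * Wnat V γ q - y) (fun hb => by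
      have := hEvF _ hb (by omega); omega) hmem
    rw [Nat.add_sub_cancel' (by omega)] at h2
    refine heU (U_of_linked hγ m heC (hB.linked heC (by omega) (by simp) fun u hu hle => ?_)
      (U_mono hnm h2))
    have := hEvB u hu hle
    omega
  have hbad : ∀ j ≤ N, (e0 + (e + j * Wnat V γ q - y)) % Wnat V γ p ∈
      (BF p).image (· % Wnat V γ p) := by
    intro j hj
    by_contra hb
    exact hout j hj (U_mono (Nat.zero_le n) (hB.mem_U_zero hγ
      (mem_ConfPlus_of_le hz1C (by omega)) hb))
  obtain ⟨t, ht0, htN, htd⟩ := exists_dvd_of_residues_mem (x := e0 + (e - y))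
    (s := Wnat V γ q) (W := Wnat V γ p) (Finset.card_image_le.trans (hN p)) (fun j hj => by
      have := hbad j hj
      rwa [show e0 + (e + j * Wnat V γ q - y) = e0 + (e - y) + j * Wnat V γ q by omega] at this)
  obtain ⟨s, hs⟩ : Wnat V γ q ∣ e - y :=
    (Nat.modEq_iff_dvd' hye.le).1 (by rw [Nat.ModEq, ← hvy.2.1, hvr, her])
  obtain ⟨j, hjt, k, hk⟩ : ∃ j < t, t ∣ s + j := by
    have h1 := Nat.mod_lt s ht0
    have h2 := Nat.mod_add_div s t
    by_cases h0 : s % t = 0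
    · exact ⟨0, ht0, Nat.dvd_of_mod_eq_zero h0⟩
    · exact ⟨t - s % t, by omega, s / t + 1, by rw [Nat.mul_succ]; omega⟩
  have hjN : j ≤ N := by omega
  have hd : Wnat V γ p ∣ e + j * Wnat V γ q - y := by
    have : e + j * Wnat V γ q - y = k * (t * Wnat V γ q) := by
      have h1 : e + j * Wnat V γ q - y = (s + j) * Wnat V γ q := by
        rw [Nat.add_mul, Nat.mul_comm s, ← hs]; omega
      rw [h1, hk]; ring
    rw [this]
    exact Dvd.dvd.mul_left htd k
  have hmod : (e0 + (e + j * Wnat V γ q - y)) % Wnat V γ p = e0 % Wnat V γ p := by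
    obtain ⟨c, hc⟩ := hd
    rw [hc, Nat.add_mul_mod_self_left]
  have he0 : e0 % Wnat V γ p = z1 % Wnat V γ p :=
    hres.resolve_right (fun h => h (hmod ▸ hbad j hjN))
  have hj1 := hjW j hjN
  refine hout j hjN (hwin _ (by omega) (hmod.trans he0) M (a + e0 - y) (T - N * N * M) hM ?_ ?_ ?_)
  · have : (N * N + N + 1) * M = N * N * M + (N + 1) * M := by ring
    omega
  · intro u hu hle
    have := hEvI u hu (by omega)
    omega
  · intro x hx1 hx2 hxd hxU
    have h1 := hdesc (x - e0) (fun hb => by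
      have := hEvF _ hb (by omega); omega) (by rwa [Nat.add_sub_cancel' (by omega)])
    refine htrack (y + (x - e0)) (by omega) (by omega) ?_ (U_mono hnm h1)
    convert hxd using 1
    omega

/-- Above a configuration of `U n`, only boundedly many configurations of its residue class lie
outside `U n`. -/
theorem exists_finset_residue_diff_U [Fintype Q] (hV : SingleGuard V) (hγ : GammaChoice V γ)
    {BF : Q → Finset ℕ} (hB : BlocksCycles V γ BF) {N : ℕ} (hN : ∀ q, (BF q).card ≤ N)
    (n : ℕ) {q : Q} {z : ℕ} (hz : (q, z) ∈ U V γ n) :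
    ∃ S : Finset ℕ,
      S.card ≤ ((Fintype.card Q * N + 1) * (N + (Fintype.card Q * (N + 1) + 1)) + N) *
        ((Fintype.card Q * N + 1) * (N * N + N + 1) + 1) ∧
      ∀ e, z ≤ e → e % Wnat V γ q = z % Wnat V γ q → (q, e) ∉ U V γ n → e ∈ S := by
  classical
  obtain ⟨Ev, hEv, hwin⟩ := exists_window_exceptions hV hγ hB hN n hz
  have hψ := card_blockedEnds_le (V := V) (γ := γ) hN n
  have hzC := U_subset_ConfPlus hγ n hz
  have hW : 0 < Wnat V γ q := hγ.Wnat_pos hzC.1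
  set k := (blockedEnds V γ BF n).card
  set X := (k + 1) * (N * N + N + 1) with hX
  refine ⟨((Ev ∪ BF q) ×ˢ Finset.range (X + 1)).image
    fun t => z % Wnat V γ q + Wnat V γ q * (t.1 / Wnat V γ q - t.2), ?_, ?_⟩
  · refine Finset.card_image_le.trans ?_
    rw [Finset.card_product, Finset.card_range]
    refine Nat.mul_le_mul ((Finset.card_union_le _ _).trans (Nat.add_le_add ?_ (hN q))) ?_
    · exact hEv.trans (Nat.mul_le_mul_right _ (by omega))
    · exact Nat.add_le_add_right (Nat.mul_le_mul_right _ (by omega)) 1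
  · intro e hze her heU
    have heC : (q, e) ∈ ConfPlus V γ := mem_ConfPlus_of_le hzC hze
    obtain ⟨u, hu, heu, hue⟩ : ∃ u ∈ Ev ∪ BF q, e ≤ u ∧ u ≤ e + X * Wnat V γ q := by
      by_contra! hcon
      refine heU (hwin e hze her (Wnat V γ q) e (X * Wnat V γ q) hW le_rfl
        (fun u hu => hcon u (Finset.mem_union_left _ hu)) ?_)
      intro x hex hxT hd hxU
      have hr : e % Wnat V γ q = x % Wnat V γ q := by
        refine (Nat.modEq_iff_dvd' hex).2 ?_
        rw [← Nat.cast_sub hex] at hd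
        exact_mod_cast hd
      refine heU (U_of_linked hγ n heC (hB.linked heC hex hr fun u hu hle => ?_) hxU)
      have := hcon u (Finset.mem_union_right _ hu) hle
      omega
    have h1 : e / Wnat V γ q ≤ u / Wnat V γ q := Nat.div_le_div_right heu
    have h2 : u / Wnat V γ q ≤ e / Wnat V γ q + X := by
      rw [← Nat.add_mul_div_right _ _ hW]
      exact Nat.div_le_div_right hue
    refine Finset.mem_image.2 ⟨(u, u / Wnat V γ q - e / Wnat V γ q), ?_, ?_⟩
    · exact Finset.mem_product.2 ⟨hu, Finset.mem_range.2 (by simp only; omega)⟩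
    · simp only
      rw [Nat.sub_sub_self h1, ← her, Nat.mod_add_div]

theorem deltaR_finite_and_ncard_le [Fintype Q] (hV : SingleGuard V) (hγ : GammaChoice V γ)
    {BF : Q → Finset ℕ} (hB : BlocksCycles V γ BF) {N : ℕ} (hN : ∀ q, (BF q).card ≤ N)
    (q : Q) (r n : ℕ) (hq : q ∈ Qplus V) (hr : r < Wnat V γ q) :
    (deltaR V γ n q r).Finite ∧ (deltaR V γ n q r).ncard ≤
      ((Fintype.card Q * N + 1) * (N + (Fintype.card Q * (N + 1) + 1)) + N) *
        ((Fintype.card Q * N + 1) * (N * N + N + 1) + 1) * N := by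
  classical
  by_cases hex : ∃ z, (q, z) ∈ U V γ n ∧ z % Wnat V γ q = r
  swap
  · have : deltaR V γ n q r = ∅ := by
      rw [Set.eq_empty_iff_forall_notMem]
      rintro c ⟨C, ⟨-, -, ⟨q', z⟩, ⟨hzU, -, rfl, hzr⟩, -⟩, -⟩
      exact hex ⟨z, hzU, hzr⟩
    simp [this]
  obtain ⟨hzU, hzr⟩ := Nat.find_spec hex
  set z := Nat.find hex with hz
  obtain ⟨S, hS, hSmem⟩ := exists_finset_residue_diff_U hV hγ hB hN n hzU
  set T : Finset (Q × ℕ) := (S ×ˢ (BF q).image (· % Wnat V γ q)).image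
    fun t => (q, t.1 + (t.2 + Wnat V γ q - r) % Wnat V γ q) with hT
  have hsub : deltaR V γ n q r ⊆ T := by
    rintro ⟨q', x⟩ ⟨C, ⟨hC, -, c, ⟨hcU, hcR⟩, c', hc'C, hcc'⟩, hxC, rfl, hxU, z1, z2,
      ⟨hz1C, hz1U⟩, ⟨hz2C, -⟩, hz1x, hxz2⟩
    simp only at hz1x hxz2 hxC hxU
    obtain ⟨hz1P, -, hz1r⟩ := hC.1 hz1C
    simp only at hz1r
    obtain ⟨qc, zc⟩ := c
    obtain ⟨-, hcq, hcr⟩ := hcR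
    simp only at hcq hcr hcc'
    subst hcq
    have hzz1 : z ≤ z1 := by
      refine (Nat.find_min' hex ⟨hcU, hcr⟩).trans ?_
      by_contra! hlt
      obtain ⟨hc'P, hc'q, hc'r⟩ := hC.1 hc'C
      have hl := IsChain.linked hγ hC hq hz1C hc'C (hlt.le.trans hcc')
      exact hz1U (U_of_linked hγ n hz1P
        (hl.of_le_left hlt.le hcc' (by simp only; rw [hz1r, hcr])).1 hcU)
    set W := Wnat V γ qc with hW
    set f := x - (x - z1) % W with hf
    have hle : (x - z1) % W ≤ x - z1 := Nat.mod_le _ _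
    have hz1f : z1 ≤ f := by omega
    have hfr : f % W = z1 % W := by
      refine ((Nat.modEq_iff_dvd' hz1f).2 ?_).symm
      have h1 := Nat.div_add_mod (x - z1) W
      exact ⟨(x - z1) / W, by omega⟩
    have hfU : (qc, f) ∉ U V γ n := by
      intro hfU
      have hl := IsChain.linked hγ hC hq hz1C hz2C (hz1x.trans hxz2)
      exact hz1U (U_of_linked hγ n hz1P
        (hl.of_le_left hz1f (by simp only; omega) hfr.symm).1 hfU)
    have hfS : f ∈ S := hSmem f (hzz1.trans hz1f) (hfr.trans (hz1r.trans hzr.symm)) hfU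
    have hxb : x % W ∈ (BF qc).image (· % W) := by
      by_contra hb
      exact hxU (U_mono (Nat.zero_le n) (hB.mem_U_zero hγ hxC hb))
    refine Finset.mem_coe.2 (Finset.mem_image.2 ⟨(f, x % W), Finset.mem_product.2 ⟨hfS, hxb⟩, ?_⟩)
    have hmod : (x % W + W - r) % W = (x - z1) % W := by
      refine Nat.ModEq.add_right_cancel' z1 ?_
      rw [Nat.sub_add_cancel hz1x]
      have h2 : x % W + W - r + z1 ≡ x % W + W - r + r [MOD W] :=
        Nat.ModEq.add_left _ (by rw [Nat.ModEq, hz1r, Nat.mod_eq_of_lt hr])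
      refine h2.trans ?_
      rw [Nat.sub_add_cancel (by omega)]
      simp [Nat.ModEq]
    simp only [Prod.mk.injEq, true_and]
    rw [hmod]
    omega
  refine ⟨T.finite_toSet.subset hsub, (Set.ncard_le_ncard hsub T.finite_toSet).trans ?_⟩
  rw [Set.ncard_coe_finset]
  refine Finset.card_image_le.trans ?_
  rw [Finset.card_product]
  exact Nat.mul_le_mul hS (Finset.card_image_le.trans (hN q))

end Counting

/-- Proposition 7: there is a polynomial `p` such that `|δ_n(R)| ≤ p(|Q|)`
for every residue class `R` and every `n`. -/
theorem deltaR_card_poly_bound :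
    ∃ p : Polynomial ℕ,
      ∀ (Q : Type) [Fintype Q] (V : OneVASS Q), SingleGuard V →
        ∀ γ : Q → List Q, GammaChoice V γ →
          ∀ (q : Q) (r n : ℕ), q ∈ Qplus V → r < Wnat V γ q →
            (deltaR V γ n q r).Finite ∧
            (deltaR V γ n q r).ncard ≤ p.eval (Fintype.card Q) := by
  open Polynomial in refine ⟨((X * (X + 1) + 1) * ((X + 1) + (X * ((X + 1) + 1) + 1)) + (X + 1)) *
    ((X * (X + 1) + 1) * ((X + 1) * (X + 1) + (X + 1) + 1) + 1) * (X + 1), ?_⟩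
  intro Q _ V hV γ hγ q r n hq hr
  obtain ⟨BF, hB, hN⟩ := exists_blocksCycles hV hγ
  simpa only [Polynomial.eval_mul, Polynomial.eval_add, Polynomial.eval_X, Polynomial.eval_one]
    using deltaR_finite_and_ncard_le hV hγ hB hN q r n hq hr

end VASSPaper
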